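/- For every integer k ≥ 3 and every y ∈ ℝ, the posterior central moments satisfy μ_{k+1}(y) = σ² · μ_k'(y) + k · σ² · μ_{k−1}(y) · μ₁'(y); that is, in the recursion for the (k+1)-th central moment, the factor μ₂(y) may be replaced by σ² μ₁'(y). -/

import Mathlib

open MeasureTheory Real

/-- A continuous function times an integrable, compactly supported one is integrable. -/
theorem integrable_continuous_mul_of_hasCompactSupport {g p : ℝ → ℝ} (hg : Continuous g)
    (hp : Integrable p) (hs : HasCompactSupport p) : Integrable (fun x => g x * p x) := by
  have h : IntegrableOn (fun x => g x * p x) (tsupport p) :=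
    hp.integrableOn.continuousOn_mul hg.continuousOn hs
  refine (integrableOn_iff_integrable_of_support_subset fun x hx => ?_).1 h
  exact subset_tsupport p fun h0 => hx (by simp [h0])

/-- Differentiation under the integral sign along a differentiable curve, for a `C¹` integrand
against an integrable, compactly supported weight. -/
theorem hasDerivAt_integral_mul_of_contDiff {E : Type*} [NormedAddCommGroup E] [NormedSpace ℝ E]
    [ProperSpace E] {F : E × ℝ → ℝ} (hF : ContDiff ℝ 1 F) {p : ℝ → ℝ} (hp : Integrable p)
    (hs : HasCompactSupport p) {γ : ℝ → E} {γ' : E} {y : ℝ} (hγ : HasDerivAt γ γ' y)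
    {f' : ℝ → ℝ} (hf' : ∀ x, HasDerivAt (fun t => F (γ t, x)) (f' x) y) :
    HasDerivAt (fun t => ∫ x, F (γ t, x) * p x) (∫ x, f' x * p x) y := by
  set L : E → ℝ → E →L[ℝ] ℝ := fun v x => (fderiv ℝ F (v, x)).comp (.inl ℝ E ℝ) with hL
  have hFL : ∀ v x, HasFDerivAt (fun u => F (u, x)) (L v x) v := fun v x =>
    (hF.differentiable one_ne_zero (v, x)).hasFDerivAt.comp v (hasFDerivAt_prodMk_left v x)
  have hLc : Continuous (Function.uncurry L) := by
    have := hF.continuous_fderiv one_ne_zero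
    simp only [hL, Function.uncurry_def]
    fun_prop
  have hLc_right : ∀ v, Continuous (L v) := fun v => hLc.comp (Continuous.prodMk_right v)
  obtain ⟨C, hC⟩ := ((isCompact_closedBall (γ y) 1).prod hs).exists_bound_of_continuousOn
    hLc.continuousOn
  have hFc : ∀ v, Continuous fun x => F (v, x) := fun v =>
    hF.continuous.comp (Continuous.prodMk_right v)
  have hLm : AEStronglyMeasurable (fun x => p x • L (γ y) x) :=
    hp.aestronglyMeasurable.smul (hLc_right _).aestronglyMeasurable
  have hbound : ∀ v ∈ Metric.closedBall (γ y) 1, ∀ x, ‖p x • L v x‖ ≤ C * ‖p x‖ := by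
    intro v hv x
    rw [norm_smul, mul_comm]
    by_cases hx : x ∈ tsupport p
    · exact mul_le_mul_of_nonneg_right (hC (v, x) ⟨hv, hx⟩) (norm_nonneg _)
    · simp [image_eq_zero_of_notMem_tsupport hx]
  have hint : Integrable (fun x => p x • L (γ y) x) :=
    (hp.norm.const_mul C).mono' hLm
      (.of_forall (hbound _ (Metric.mem_closedBall_self zero_le_one)))
  have hderiv : HasFDerivAt (fun v => ∫ x, F (v, x) * p x) (∫ x, p x • L (γ y) x) (γ y) :=
    hasFDerivAt_integral_of_dominated_of_fderiv_le
      (F' := fun v x => p x • L v x)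
      (Metric.closedBall_mem_nhds (γ y) one_pos)
      (.of_forall fun v =>
        (integrable_continuous_mul_of_hasCompactSupport (hFc v) hp hs).aestronglyMeasurable)
      (integrable_continuous_mul_of_hasCompactSupport (hFc _) hp hs) hLm
      (.of_forall fun x v hv => hbound v hv x) (hp.norm.const_mul C)
      (.of_forall fun x v _ => (hFL v x).mul_const (p x))
  have hcomp := hderiv.comp_hasDerivAt y hγ
  rw [ContinuousLinearMap.integral_apply hint] at hcomp
  refine hcomp.congr_deriv (integral_congr_ae (.of_forall fun x => ?_))
  have := (hf' x).unique ((hFL (γ y) x).comp_hasDerivAt y hγ)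
  simp [this, mul_comm]

/-- For every `k ≥ 3` and every `y`, the posterior central moments satisfy
`μ_{k+1}(y) = σ² μ_k'(y) + k σ² μ_{k−1}(y) μ₁'(y)`. -/
theorem central_moment_recursion_via_deriv_mean
    (σ : ℝ) (hσ : 0 < σ)
    (p : ℝ → ℝ) (hp_meas : Measurable p) (hp_nonneg : ∀ x, 0 ≤ p x)
    (hp_bdd : ∃ C, ∀ x, p x ≤ C) (hp_supp : HasCompactSupport p)
    (hp_int : ∫ x, p x = 1)
    (φ : ℝ → ℝ)
    (hφ : ∀ t, φ t = (2 * π * σ ^ 2) ^ (-(1 : ℝ) / 2) * Real.exp (-t ^ 2 / (2 * σ ^ 2)))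
    (pY : ℝ → ℝ) (hpY : ∀ y, pY y = ∫ x, φ (y - x) * p x)
    (hpY_pos : ∀ y, 0 < pY y)
    (μ₁ : ℝ → ℝ) (hμ₁ : ∀ y, μ₁ y = (∫ x, x * φ (y - x) * p x) / pY y)
    (hμ₁_diff : Differentiable ℝ μ₁)
    (μ : ℕ → ℝ → ℝ)
    (hμ : ∀ k, 2 ≤ k → ∀ y, μ k y = (∫ x, (x - μ₁ y) ^ k * φ (y - x) * p x) / pY y)
    (hμ_diff : ∀ k, 2 ≤ k → Differentiable ℝ (μ k)) :
    ∀ k : ℕ, 3 ≤ k → ∀ y : ℝ,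
      μ (k + 1) y = σ ^ 2 * deriv (μ k) y + (k : ℝ) * σ ^ 2 * μ (k - 1) y * deriv μ₁ y := by
  have hp : Integrable p := integrable_of_integral_eq_one hp_int
  have hφ_contDiff : ContDiff ℝ 1 φ := by
    rw [funext hφ]
    fun_prop
  have hφ_deriv (t : ℝ) : HasDerivAt φ (-t / σ ^ 2 * φ t) t := by
    rw [funext hφ]
    refine ((((hasDerivAt_id t).pow 2).neg.div_const (2 * σ ^ 2)).exp.const_mul
      ((2 * π * σ ^ 2) ^ (-(1 : ℝ) / 2))).congr_deriv ?_
    simp only [id, Pi.neg_apply, Pi.pow_apply]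
    field_simp
    norm_num
  set N : ℕ → ℝ → ℝ := fun j y => ∫ x, (x - μ₁ y) ^ j * φ (y - x) * p x with hN
  have hN_int (j : ℕ) (y : ℝ) : Integrable fun x => (x - μ₁ y) ^ j * φ (y - x) * p x := by
    have := hφ_contDiff.continuous
    exact integrable_continuous_mul_of_hasCompactSupport (by fun_prop) hp hp_supp
  have hN_deriv (j : ℕ) (y : ℝ) : HasDerivAt (N j)
      (-j * deriv μ₁ y * N (j - 1) y + (N (j + 1) y + (μ₁ y - y) * N j y) / σ ^ 2) y := by
    have hμ₁' := (hμ₁_diff y).hasDerivAt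
    have h := hasDerivAt_integral_mul_of_contDiff (E := ℝ × ℝ)
      (F := fun q => (q.2 - q.1.1) ^ j * φ (q.1.2 - q.2)) (by fun_prop) hp hp_supp
      (hμ₁'.prodMk (hasDerivAt_id y))
      (fun x => ((hμ₁'.const_sub x).pow j).mul
        ((hφ_deriv (y - x)).comp y ((hasDerivAt_id y).sub_const x)))
    refine h.congr_deriv (Eq.symm ?_)
    simp only [hN]
    rw [← integral_const_mul, ← integral_const_mul,
      ← integral_add (hN_int _ _) ((hN_int _ _).const_mul _), ← integral_div,
      ← integral_add ((hN_int _ _).const_mul _)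
        (((hN_int _ _).fun_add ((hN_int _ _).const_mul _)).div_const _)]
    refine integral_congr_ae (.of_forall fun x => ?_)
    simp only [id, Pi.pow_apply]
    field_simp
    ring
  have hN_zero : N 0 = pY := by
    ext y
    simp [hN, hpY]
  have hN_one (y : ℝ) : N 1 y = 0 := by
    have hφ_cont := hφ_contDiff.continuous
    have h_eq : N 1 y = (∫ x, x * φ (y - x) * p x) - μ₁ y * pY y := by
      rw [hpY, ← integral_const_mul, ← integral_sub]
      · exact integral_congr_ae (.of_forall fun x => by ring)
      · exact integrable_continuous_mul_of_hasCompactSupport (by fun_prop) hp hp_supp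
      · exact (integrable_continuous_mul_of_hasCompactSupport (by fun_prop) hp hp_supp).const_mul _
    rw [h_eq, hμ₁ y, div_mul_cancel₀ _ (hpY_pos y).ne', sub_self]
  intro k hk y
  have hpY_deriv := hN_deriv 0 y
  rw [hN_zero] at hpY_deriv
  have hμ_eq : μ k = fun t => N k t / pY t := funext (hμ k (by lia))
  have hμ_deriv := ((hN_deriv k y).fun_div hpY_deriv (hpY_pos y).ne').deriv
  rw [← hμ_eq] at hμ_deriv
  rw [hμ_deriv, hμ (k + 1) (by lia), hμ (k - 1) (by lia)]
  change N (k + 1) y / pY y = _ + _ * (N (k - 1) y / pY y) * _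
  have hpos := (hpY_pos y).ne'
  simp only [zero_add, hN_one]
  field_simp
  push_cast
  ring
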